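/- arXiv:2103.12881 — 2 statements merged into one kernel-verified Lean document; each statement's English description precedes it below -/
import Mathlib

section
/- In any controlled hidden Markov model with output-feedback policy over horizon T ≥ 1, the smoother entropy satisfies H(X^T | Y^T, U^{T-1}) = H(X_0 | Y_0) + ∑_{t=1}^{T} [ H(X_t | X_{t-1}, Y^{t-1}, U^{t-1}) − I(X_t ; Y_t | Y^{t-1}, U^{t-1}) ]. -/
open Finset

/-- Trajectory space of a controlled HMM over horizon `T`:
states `x_0,…,x_T`, measurements `y_0,…,y_T`, controls `u_0,…,u_{T-1}`. -/
abbrev Traj (T : ℕ) (X Y U : Type*) : Type _ :=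
  (Fin (T + 1) → X) × (Fin (T + 1) → Y) × (Fin T → U)

/-- A controlled hidden Markov model with output-feedback policy over horizon `T`,
with finite state space `X`, measurement space `Y` and control space `U`.
`f t x' x u = f_t(x' | x, u)`, `g0 y x = g₀(y | x)`, `g t y x u = g_{t+1}(y | x, u_t)`,
and `pol t a ys us = μ_t(a | y^t, u^{t-1})` (causality is imposed by `pol_causal`). -/
structure CHMM (T : ℕ) (X Y U : Type*) [Fintype X] [Fintype Y] [Fintype U] where
  p0 : X → ℝ
  f : Fin T → X → X → U → ℝ
  g0 : Y → X → ℝ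
  g : Fin T → Y → X → U → ℝ
  pol : Fin T → U → (Fin (T + 1) → Y) → (Fin T → U) → ℝ
  p0_nonneg : ∀ x, 0 ≤ p0 x
  p0_sum : ∑ x, p0 x = 1
  f_nonneg : ∀ t x' x u, 0 ≤ f t x' x u
  f_sum : ∀ t x u, ∑ x', f t x' x u = 1
  g0_nonneg : ∀ y x, 0 ≤ g0 y x
  g0_sum : ∀ x, ∑ y, g0 y x = 1
  g_nonneg : ∀ t y x u, 0 ≤ g t y x u
  g_sum : ∀ t x u, ∑ y, g t y x u = 1
  pol_nonneg : ∀ t a ys us, 0 ≤ pol t a ys us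
  pol_sum : ∀ t ys us, ∑ a, pol t a ys us = 1
  pol_causal : ∀ (t : Fin T) (a : U) (ys ys' : Fin (T + 1) → Y) (us us' : Fin T → U),
    (∀ i : Fin (T + 1), (i : ℕ) ≤ (t : ℕ) → ys i = ys' i) →
    (∀ i : Fin T, (i : ℕ) < (t : ℕ) → us i = us' i) →
    pol t a ys us = pol t a ys' us'

variable {T : ℕ} {X Y U : Type*} [Fintype X] [Fintype Y] [Fintype U]
  [DecidableEq X] [DecidableEq Y] [DecidableEq U]

/-- The joint probability mass function on trajectories induced by a controlled HMM. -/
noncomputable def CHMM.p (M : CHMM T X Y U) (ω : Traj T X Y U) : ℝ :=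
  M.p0 (ω.1 0) * M.g0 (ω.2.1 0) (ω.1 0) *
    ∏ t : Fin T,
      (M.pol t (ω.2.2 t) ω.2.1 ω.2.2 *
        M.f t (ω.1 t.succ) (ω.1 t.castSucc) (ω.2.2 t) *
        M.g t (ω.2.1 t.succ) (ω.1 t.succ) (ω.2.2 t))

/-- `M.prob A a = P(A = a)` for a random variable `A` on trajectory space. -/
noncomputable def CHMM.prob (M : CHMM T X Y U) {α : Type*} [DecidableEq α]
    (A : Traj T X Y U → α) (a : α) : ℝ :=
  ∑ ω : Traj T X Y U, if A ω = a then M.p ω else 0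

/-- `M.cprob A a B b = P(A = a | B = b) = P(A = a, B = b) / P(B = b)`. -/
noncomputable def CHMM.cprob (M : CHMM T X Y U) {α β : Type*} [DecidableEq α] [DecidableEq β]
    (A : Traj T X Y U → α) (a : α) (B : Traj T X Y U → β) (b : β) : ℝ :=
  M.prob (fun ω => (A ω, B ω)) (a, b) / M.prob B b

/-- Shannon entropy `H(A)` of a random variable `A` (with `0 log 0 = 0`, as `Real.log 0 = 0`). -/
noncomputable def CHMM.entropy (M : CHMM T X Y U) {α : Type*} [Fintype α] [DecidableEq α]
    (A : Traj T X Y U → α) : ℝ :=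
  -∑ a : α, M.prob A a * Real.log (M.prob A a)

/-- Conditional entropy `H(A | B) = -∑_{a,b} P(A=a,B=b) log P(A=a|B=b)`
(terms with `P(A=a,B=b) = 0`, in particular those with `P(B=b) = 0`, vanish). -/
noncomputable def CHMM.condEnt (M : CHMM T X Y U) {α β : Type*}
    [Fintype α] [DecidableEq α] [Fintype β] [DecidableEq β]
    (A : Traj T X Y U → α) (B : Traj T X Y U → β) : ℝ :=
  -∑ a : α, ∑ b : β,
      M.prob (fun ω => (A ω, B ω)) (a, b) *
        Real.log (M.prob (fun ω => (A ω, B ω)) (a, b) / M.prob B b)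

/-- Conditional mutual information `I(A ; B | C) = H(A | C) - H(A | B, C)`. -/
noncomputable def CHMM.condMI (M : CHMM T X Y U) {α β γ : Type*}
    [Fintype α] [DecidableEq α] [Fintype β] [DecidableEq β] [Fintype γ] [DecidableEq γ]
    (A : Traj T X Y U → α) (B : Traj T X Y U → β) (C : Traj T X Y U → γ) : ℝ :=
  M.condEnt A C - M.condEnt A (fun ω => (B ω, C ω))

/-- Point-wise conditional entropy `h(A | b) = -∑_a P(A=a|B=b) log P(A=a|B=b)`. -/
noncomputable def CHMM.pcondEnt (M : CHMM T X Y U) {α β : Type*}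
    [Fintype α] [DecidableEq α] [DecidableEq β]
    (A : Traj T X Y U → α) (B : Traj T X Y U → β) (b : β) : ℝ :=
  -∑ a : α, M.cprob A a B b * Real.log (M.cprob A a B b)

/-- Point-wise conditional entropy of `A` given the random variable `A'` and the
realization `B = b`:  `h(A | A', b) = -∑_{a,a'} P(A=a,A'=a'|B=b) log P(A=a|A'=a',B=b)`. -/
noncomputable def CHMM.pcondEnt2 (M : CHMM T X Y U) {α α' β : Type*}
    [Fintype α] [DecidableEq α] [Fintype α'] [DecidableEq α'] [DecidableEq β]
    (A : Traj T X Y U → α) (A' : Traj T X Y U → α') (B : Traj T X Y U → β) (b : β) : ℝ :=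
  -∑ a : α, ∑ a' : α',
      M.cprob (fun ω => (A ω, A' ω)) (a, a') B b *
        Real.log (M.prob (fun ω => (A ω, (A' ω, B ω))) (a, (a', b)) /
          M.prob (fun ω => (A' ω, B ω)) (a', b))

/-- The state history `X^{n-1} = (X_0, …, X_{n-1})` as a random variable. -/
def Xpref (T : ℕ) {X Y U : Type*} (n : ℕ) (h : n ≤ T + 1) :
    Traj T X Y U → (Fin n → X) :=
  fun ω i => ω.1 (Fin.castLE h i)

/-- The measurement history `Y^{n-1} = (Y_0, …, Y_{n-1})` as a random variable. -/
def Ypref (T : ℕ) {X Y U : Type*} (n : ℕ) (h : n ≤ T + 1) :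
    Traj T X Y U → (Fin n → Y) :=
  fun ω i => ω.2.1 (Fin.castLE h i)

/-- The control history `U^{n-1} = (U_0, …, U_{n-1})` as a random variable. -/
def Upref (T : ℕ) {X Y U : Type*} (n : ℕ) (h : n ≤ T) :
    Traj T X Y U → (Fin n → U) :=
  fun ω i => ω.2.2 (Fin.castLE h i)

/-- The state `X_t` as a random variable. -/
def Xat (T : ℕ) {X Y U : Type*} (t : ℕ) (h : t < T + 1) : Traj T X Y U → X :=
  fun ω => ω.1 ⟨t, h⟩

/-- The measurement `Y_t` as a random variable. -/
def Yat (T : ℕ) {X Y U : Type*} (t : ℕ) (h : t < T + 1) : Traj T X Y U → Y :=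
  fun ω => ω.2.1 ⟨t, h⟩

/-- The control `U_t` as a random variable. -/
def Uat (T : ℕ) {X Y U : Type*} (t : ℕ) (h : t < T) : Traj T X Y U → U :=
  fun ω => ω.2.2 ⟨t, h⟩

namespace SmootherAux

/-- Probability of the fibre of `A` through `ω`. -/
noncomputable def P {Ω α : Type*} [Fintype Ω] [DecidableEq α] (p : Ω → ℝ) (A : Ω → α) (ω : Ω) : ℝ :=
  ∑ ω', if A ω' = A ω then p ω' else 0

/-- Entropy written as a sum over the sample space. -/
noncomputable def HH {Ω α : Type*} [Fintype Ω] [DecidableEq α] (p : Ω → ℝ) (A : Ω → α) : ℝ :=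
  -∑ ω, p ω * Real.log (P p A ω)

theorem P_congr {Ω α β : Type*} [Fintype Ω] [DecidableEq α] [DecidableEq β] (p : Ω → ℝ)
    (A : Ω → α) (B : Ω → β) (h : ∀ ω ω', A ω = A ω' ↔ B ω = B ω') (ω : Ω) :
    P p A ω = P p B ω := by
  unfold P
  exact Finset.sum_congr rfl fun ω' _ => by simp only [h ω' ω]

theorem HH_congr {Ω α β : Type*} [Fintype Ω] [DecidableEq α] [DecidableEq β] (p : Ω → ℝ)
    (A : Ω → α) (B : Ω → β) (h : ∀ ω ω', A ω = A ω' ↔ B ω = B ω') :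
    HH p A = HH p B := by
  unfold HH
  simp only [P_congr p A B h]

theorem P_pos {Ω α : Type*} [Fintype Ω] [DecidableEq α] (p : Ω → ℝ) (hp : ∀ ω, 0 ≤ p ω)
    (A : Ω → α) (ω : Ω) (h : p ω ≠ 0) : 0 < P p A ω := by
  have h1 : 0 < p ω := lt_of_le_of_ne (hp ω) (Ne.symm h)
  refine lt_of_lt_of_le h1 ?_
  unfold P
  have := Finset.single_le_sum (f := fun ω' => if A ω' = A ω then p ω' else 0)
    (fun i _ => by split_ifs <;> simp [hp]) (Finset.mem_univ ω)
  simpa using this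

theorem step {Ω α β γ δ ε : Type*} [Fintype Ω] [Fintype α] [DecidableEq α]
    [Fintype β] [DecidableEq β]
    [DecidableEq γ] [DecidableEq δ] [DecidableEq ε] (p : Ω → ℝ) (hp : ∀ ω, 0 ≤ p ω)
    (A : Ω → α) (W : Ω → β) (AW : Ω → γ) (B : Ω → δ) (BW : Ω → ε)
    (hAW : ∀ ω ω', AW ω = AW ω' ↔ A ω = A ω' ∧ W ω = W ω')
    (hBW : ∀ ω ω', BW ω = BW ω' ↔ B ω = B ω' ∧ W ω = W ω')
    (hAB : ∀ ω ω', A ω = A ω' → B ω = B ω')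
    (upd : Ω → β → Ω) (hA : ∀ ω w, A (upd ω w) = A ω) (hW : ∀ ω w, W (upd ω w) = w)
    (q k : Ω → ℝ) (hq : ∀ ω w, q (upd ω w) = q ω) (hk : ∀ ω, ∑ w, k (upd ω w) = 1)
    (hkB : ∀ ω ω', B ω = B ω' → W ω = W ω' → k ω = k ω')
    (hP : ∀ ω, P p AW ω = q ω * k ω) :
    (∀ ω, P p A ω = q ω) ∧ HH p AW - HH p A = HH p BW - HH p B := by
  have h1 : ∀ ω, P p A ω = q ω := by
    intro ω
    have : P p A ω = ∑ w, P p AW (upd ω w) := by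
      unfold P
      rw [Finset.sum_comm]
      refine Finset.sum_congr rfl fun ω' _ => ?_
      simp only [hAW, hA, hW]
      by_cases h : A ω' = A ω <;> simp [h]
    rw [this]
    simp only [hP, hq]
    rw [← Finset.mul_sum, hk, mul_one]
  have h2 : ∀ ω, P p BW ω = P p B ω * k ω := by
    intro ω
    unfold P
    rw [← Finset.sum_fiberwise (s := Finset.univ) (g := A)
        (f := fun ω' => if BW ω' = BW ω then p ω' else 0),
      ← Finset.sum_fiberwise (s := Finset.univ) (g := A)
        (f := fun ω' => if B ω' = B ω then p ω' else 0), Finset.sum_mul]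
    refine Finset.sum_congr rfl fun a _ => ?_
    rw [Finset.sum_filter, Finset.sum_filter]
    by_cases ha : ∃ ω₁, A ω₁ = a
    · obtain ⟨ω₁, rfl⟩ := ha
      by_cases hb : B ω₁ = B ω
      · have e1 : (∑ ω', if A ω' = A ω₁ then (if BW ω' = BW ω then p ω' else 0) else 0)
            = P p AW (upd ω₁ (W ω)) := by
          unfold P
          refine Finset.sum_congr rfl fun ω' _ => ?_
          simp only [hAW, hA, hW, hBW]
          by_cases h : A ω' = A ω₁
          · simp [h, (hAB _ _ h).trans hb]
          · simp [h]
        have e2 : (∑ ω', if A ω' = A ω₁ then (if B ω' = B ω then p ω' else 0) else 0)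
            = P p A ω₁ := by
          unfold P
          refine Finset.sum_congr rfl fun ω' _ => ?_
          by_cases h : A ω' = A ω₁
          · simp [h, (hAB _ _ h).trans hb]
          · simp [h]
        rw [e1, e2, hP, hq, h1]
        congr 1
        exact hkB _ _ ((hAB _ _ (hA _ _)).trans hb) (hW _ _)
      · rw [Finset.sum_eq_zero, Finset.sum_eq_zero, zero_mul]
        · intro ω' _
          split_ifs with h h'
          · exact absurd ((hAB _ _ h).symm.trans h') hb
          · rfl
          · rfl
        · intro ω' _
          split_ifs with h h'
          · exact absurd ((hAB _ _ h).symm.trans ((hBW _ _).1 h').1) hb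
          · rfl
          · rfl
    · have : ∀ ω', A ω' ≠ a := fun ω' h => ha ⟨ω', h⟩
      simp [this]
  refine ⟨h1, ?_⟩
  unfold HH
  rw [neg_sub_neg, neg_sub_neg, ← Finset.sum_sub_distrib, ← Finset.sum_sub_distrib]
  refine Finset.sum_congr rfl fun ω _ => ?_
  by_cases h : p ω = 0
  · simp [h]
  have a1 := P_pos p hp A ω h
  have a2 := P_pos p hp AW ω h
  have b1 := P_pos p hp B ω h
  rw [hP, ← h1] at a2
  have hk0 : k ω ≠ 0 := fun h => by simp [h] at a2
  rw [hP, h2, ← h1, Real.log_mul a1.ne' hk0, Real.log_mul b1.ne' hk0]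
  ring

theorem condEnt_eq {T : ℕ} {X Y U : Type*} [Fintype X] [Fintype Y] [Fintype U]
    [DecidableEq X] [DecidableEq Y] [DecidableEq U] (M : CHMM T X Y U) (hp : ∀ ω, 0 ≤ M.p ω)
    {α β : Type*} [Fintype α] [DecidableEq α] [Fintype β] [DecidableEq β]
    (A : Traj T X Y U → α) (B : Traj T X Y U → β) :
    M.condEnt A B = HH M.p (fun ω => (A ω, B ω)) - HH M.p B := by
  unfold CHMM.condEnt HH
  rw [neg_sub_neg, ← Finset.sum_sub_distrib, ← Finset.sum_neg_distrib,
    ← Finset.sum_fiberwise (s := Finset.univ) (g := A)]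
  refine Finset.sum_congr rfl fun a _ => ?_
  rw [← Finset.sum_fiberwise _ B, ← Finset.sum_neg_distrib]
  refine Finset.sum_congr rfl fun b _ => ?_
  rw [Finset.filter_filter, Finset.sum_filter]
  rw [show M.prob (fun ω => (A ω, B ω)) (a, b) =
    ∑ ω, if A ω = a ∧ B ω = b then M.p ω else 0 by simp only [CHMM.prob, Prod.mk.injEq]]
  rw [Finset.sum_mul, ← Finset.sum_neg_distrib]
  refine Finset.sum_congr rfl fun ω _ => ?_
  split_ifs with h
  · by_cases h0 : M.p ω = 0
    · simp [h0]
    have a1 := P_pos M.p hp (fun ω => (A ω, B ω)) ω h0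
    have a2 := P_pos M.p hp B ω h0
    obtain ⟨rfl, rfl⟩ := h
    have e1 : (∑ ω', if A ω' = A ω ∧ B ω' = B ω then M.p ω' else 0)
        = P M.p (fun ω => (A ω, B ω)) ω := by simp only [P, Prod.mk.injEq]
    have e2 : M.prob B (B ω) = P M.p B ω := rfl
    rw [e1, e2, Real.log_div a1.ne' a2.ne']
    ring
  · simp

section
variable {T : ℕ} {X Y U : Type*}

theorem Xpref_iff (n : ℕ) (h : n ≤ T + 1) (ω ω' : Traj T X Y U) :
    Xpref T n h ω = Xpref T n h ω' ↔ ∀ i : Fin (T + 1), (i : ℕ) < n → ω.1 i = ω'.1 i :=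
  ⟨fun e i hi => congrFun e ⟨i, hi⟩, fun e => funext fun i => e _ i.isLt⟩

theorem Ypref_iff (n : ℕ) (h : n ≤ T + 1) (ω ω' : Traj T X Y U) :
    Ypref T n h ω = Ypref T n h ω' ↔ ∀ i : Fin (T + 1), (i : ℕ) < n → ω.2.1 i = ω'.2.1 i :=
  ⟨fun e i hi => congrFun e ⟨i, hi⟩, fun e => funext fun i => e _ i.isLt⟩

theorem Upref_iff (n : ℕ) (h : n ≤ T) (ω ω' : Traj T X Y U) :
    Upref T n h ω = Upref T n h ω' ↔ ∀ i : Fin T, (i : ℕ) < n → ω.2.2 i = ω'.2.2 i :=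
  ⟨fun e i hi => congrFun e ⟨i, hi⟩, fun e => funext fun i => e _ i.isLt⟩

theorem fin_succ_iff {m : ℕ} (n : ℕ) (hn : n < m) (Q : Fin m → Prop) :
    (∀ i : Fin m, (i : ℕ) < n + 1 → Q i) ↔ (∀ i : Fin m, (i : ℕ) < n → Q i) ∧ Q ⟨n, hn⟩ := by
  refine ⟨fun h => ⟨fun i hi => h i (by omega), h _ (by simp)⟩, fun h i hi => ?_⟩
  rcases Nat.lt_succ_iff_lt_or_eq.1 hi with h' | h'
  · exact h.1 i h'
  · have : i = ⟨n, hn⟩ := Fin.ext h'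
    rw [this]; exact h.2

theorem Xpref_succ (n : ℕ) (h : n + 1 ≤ T + 1) (ω ω' : Traj T X Y U) :
    Xpref T (n + 1) h ω = Xpref T (n + 1) h ω' ↔
      Xpref T n (by omega) ω = Xpref T n (by omega) ω' ∧ Xat T n h ω = Xat T n h ω' := by
  rw [Xpref_iff, Xpref_iff, fin_succ_iff n h]; rfl

theorem Ypref_succ (n : ℕ) (h : n + 1 ≤ T + 1) (ω ω' : Traj T X Y U) :
    Ypref T (n + 1) h ω = Ypref T (n + 1) h ω' ↔
      Ypref T n (by omega) ω = Ypref T n (by omega) ω' ∧ Yat T n h ω = Yat T n h ω' := by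
  rw [Ypref_iff, Ypref_iff, fin_succ_iff n h]; rfl

theorem Upref_succ (n : ℕ) (h : n + 1 ≤ T) (ω ω' : Traj T X Y U) :
    Upref T (n + 1) h ω = Upref T (n + 1) h ω' ↔
      Upref T n (by omega) ω = Upref T n (by omega) ω' ∧ Uat T n h ω = Uat T n h ω' := by
  rw [Upref_iff, Upref_iff, fin_succ_iff n h]; rfl

variable [Fintype X] [Fintype Y] [Fintype U]
  [DecidableEq X] [DecidableEq Y] [DecidableEq U]

/-- Truncated product. -/
noncomputable def qq (M : CHMM T X Y U) (n : ℕ) (ω : Traj T X Y U) : ℝ :=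
  M.p0 (ω.1 0) * M.g0 (ω.2.1 0) (ω.1 0) *
    ∏ t : Fin T, if (t : ℕ) < n then
      (M.pol t (ω.2.2 t) ω.2.1 ω.2.2 *
        M.f t (ω.1 t.succ) (ω.1 t.castSucc) (ω.2.2 t) *
        M.g t (ω.2.1 t.succ) (ω.1 t.succ) (ω.2.2 t)) else 1

theorem p_nonneg (M : CHMM T X Y U) (ω) : 0 ≤ M.p ω :=
  mul_nonneg (mul_nonneg (M.p0_nonneg _) (M.g0_nonneg _ _))
    (Finset.prod_nonneg fun _ _ => mul_nonneg (mul_nonneg (M.pol_nonneg _ _ _ _)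
      (M.f_nonneg _ _ _ _)) (M.g_nonneg _ _ _ _))

theorem qq_T (M : CHMM T X Y U) (ω) : qq M T ω = M.p ω := by
  simp [qq, CHMM.p]

theorem qq_succ (M : CHMM T X Y U) (n : ℕ) (hn : n < T) (ω) : qq M (n + 1) ω =
    qq M n ω * M.pol ⟨n, hn⟩ (ω.2.2 ⟨n, hn⟩) ω.2.1 ω.2.2 *
      M.f ⟨n, hn⟩ (ω.1 ⟨n + 1, by omega⟩) (ω.1 ⟨n, by omega⟩) (ω.2.2 ⟨n, hn⟩) *
      M.g ⟨n, hn⟩ (ω.2.1 ⟨n + 1, by omega⟩) (ω.1 ⟨n + 1, by omega⟩) (ω.2.2 ⟨n, hn⟩) := by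
  unfold qq
  have e : ∀ F : Fin T → ℝ, (∏ t : Fin T, if (t : ℕ) < n + 1 then F t else 1) =
      (∏ t : Fin T, if (t : ℕ) < n then F t else 1) * F ⟨n, hn⟩ := by
    intro F
    have : F ⟨n, hn⟩ = ∏ t : Fin T, if t = ⟨n, hn⟩ then F t else 1 := by simp
    rw [this, ← Finset.prod_mul_distrib]
    refine Finset.prod_congr rfl fun t _ => ?_
    rcases lt_trichotomy (t : ℕ) n with h | h | h
    · have : t ≠ ⟨n, hn⟩ := fun h' => by simp [h'] at h
      simp [h, this, Nat.lt_succ_of_lt h]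
    · have : t = ⟨n, hn⟩ := Fin.ext h
      subst this; simp
    · have : t ≠ ⟨n, hn⟩ := fun h' => by simp [h'] at h
      simp [this, show ¬ (t : ℕ) < n + 1 by omega, show ¬ (t : ℕ) < n by omega]
  rw [e]
  simp only [Fin.succ_mk, Fin.castSucc_mk]
  ring

theorem qq_congr (M : CHMM T X Y U) (n : ℕ) (ω ω' : Traj T X Y U)
    (hx : ∀ i : Fin (T + 1), (i : ℕ) < n + 1 → ω.1 i = ω'.1 i)
    (hy : ∀ i : Fin (T + 1), (i : ℕ) < n + 1 → ω.2.1 i = ω'.2.1 i)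
    (hu : ∀ i : Fin T, (i : ℕ) < n → ω.2.2 i = ω'.2.2 i) : qq M n ω = qq M n ω' := by
  unfold qq
  rw [hx 0 (by simp), hy 0 (by simp)]
  congr 1
  refine Finset.prod_congr rfl fun t _ => ?_
  split_ifs with h
  · rw [hx t.succ (by simp; omega), hx t.castSucc (by simp; omega), hy t.succ (by simp; omega),
      hu t h, M.pol_causal t _ ω.2.1 ω'.2.1 ω.2.2 ω'.2.2 (fun i hi => hy i (by omega))
        (fun i hi => hu i (by omega))]
  · rfl

/-- Full history up to time `n`. -/
abbrev full (T : ℕ) {X Y U : Type*} (n : ℕ) (h : n ≤ T) :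
    Traj T X Y U → (Fin (n + 1) → X) × (Fin (n + 1) → Y) × (Fin n → U) :=
  fun ω => (Xpref T (n + 1) (by omega) ω, Ypref T (n + 1) (by omega) ω, Upref T n h ω)

theorem level (M : CHMM T X Y U) (n : ℕ) (hn : n < T)
    (hP : ∀ ω, P M.p (full T (n + 1) hn) ω = qq M (n + 1) ω) :
    (∀ ω, P M.p (full T n hn.le) ω = qq M n ω) ∧
    M.condEnt (Xpref T (n + 2) (by omega))
        (fun ω => (Ypref T (n + 2) (by omega) ω, Upref T (n + 1) hn ω)) -
      M.condEnt (Xpref T (n + 1) (by omega))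
        (fun ω => (Ypref T (n + 1) (by omega) ω, Upref T n hn.le ω)) =
      M.condEnt (Xat T (n + 1) (by omega))
          (fun ω => (Xat T n (by omega) ω, Ypref T (n + 1) (by omega) ω, Upref T (n + 1) hn ω))
        - M.condMI (Xat T (n + 1) (by omega)) (Yat T (n + 1) (by omega))
            (fun ω => (Ypref T (n + 1) (by omega) ω, Upref T (n + 1) hn ω)) := by
  have hp := p_nonneg M
  have lt1 : n + 1 < T + 1 := by omega
  have lt0 : n < T + 1 := by omega
  let A2 : Traj T X Y U → _ := fun ω => (Xpref T (n + 2) (by omega) ω,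
    Ypref T (n + 1) (by omega) ω, Upref T (n + 1) hn ω)
  let A1 : Traj T X Y U → _ := fun ω => (Xpref T (n + 1) (by omega) ω,
    Ypref T (n + 1) (by omega) ω, Upref T (n + 1) hn ω)
  let C : Traj T X Y U → _ := fun ω => (Ypref T (n + 1) (by omega) ω, Upref T (n + 1) hn ω)
  obtain ⟨P2, E2⟩ := step M.p hp A2 (Yat T (n + 1) lt1) (full T (n + 1) hn)
    (fun ω => (Xat T (n + 1) lt1 ω, C ω))
    (fun ω => (Xat T (n + 1) lt1 ω, (Yat T (n + 1) lt1 ω, C ω)))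
    (by intro ω ω'; simp only [full, A2, Prod.mk.injEq]
        rw [Ypref_succ (n + 1)]; tauto)
    (by intro ω ω'; simp only [C, Prod.mk.injEq]; tauto)
    (by intro ω ω'; simp only [A2, C, Prod.mk.injEq]
        rw [Xpref_succ (n + 1)]; tauto)
    (fun ω w => (ω.1, Function.update ω.2.1 ⟨n + 1, lt1⟩ w, ω.2.2))
    (by intro ω w; simp only [A2, Prod.mk.injEq, Xpref_iff, Ypref_iff, Upref_iff]
        refine ⟨fun _ _ => trivial, fun i hi => ?_, fun _ _ => trivial⟩
        rw [Function.update_of_ne]; intro h; simp [h] at hi)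
    (by intro ω w; simp [Yat])
    (fun ω => qq M n ω * M.pol ⟨n, hn⟩ (ω.2.2 ⟨n, hn⟩) ω.2.1 ω.2.2 *
      M.f ⟨n, hn⟩ (ω.1 ⟨n + 1, lt1⟩) (ω.1 ⟨n, lt0⟩) (ω.2.2 ⟨n, hn⟩))
    (fun ω => M.g ⟨n, hn⟩ (ω.2.1 ⟨n + 1, lt1⟩) (ω.1 ⟨n + 1, lt1⟩) (ω.2.2 ⟨n, hn⟩))
    (by intro ω w
        have hy : ∀ i : Fin (T + 1), (i : ℕ) < n + 1 →
            Function.update ω.2.1 ⟨n + 1, lt1⟩ w i = ω.2.1 i := fun i hi => by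
          rw [Function.update_of_ne]; intro h; simp [h] at hi
        dsimp only
        rw [qq_congr M n (ω.1, Function.update ω.2.1 ⟨n + 1, lt1⟩ w, ω.2.2) ω
            (fun _ _ => rfl) hy (fun _ _ => rfl),
          M.pol_causal ⟨n, hn⟩ _ (Function.update ω.2.1 ⟨n + 1, lt1⟩ w) ω.2.1 ω.2.2 ω.2.2
            (fun i hi => hy i (Nat.lt_succ_of_le hi)) (fun _ _ => rfl)])
    (by intro ω; simp [M.g_sum])
    (by intro ω ω' h1 h2
        simp only [C, Prod.mk.injEq, Upref_iff, Xat] at h1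
        simp only [Yat] at h2
        rw [h1.1, h2, h1.2.2 ⟨n, hn⟩ (by simp)])
    (by intro ω; rw [hP, qq_succ M n hn])
  obtain ⟨P1, E1⟩ := step M.p hp A1 (Xat T (n + 1) lt1) A2
    (fun ω => (Xat T n lt0 ω, C ω))
    (fun ω => (Xat T (n + 1) lt1 ω, (Xat T n lt0 ω, C ω)))
    (by intro ω ω'; simp only [A1, A2, Prod.mk.injEq]
        rw [Xpref_succ (n + 1)]; tauto)
    (by intro ω ω'; simp only [C, Prod.mk.injEq]; tauto)
    (by intro ω ω'; simp only [A1, C, Prod.mk.injEq]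
        rw [Xpref_succ n]; tauto)
    (fun ω w => (Function.update ω.1 ⟨n + 1, lt1⟩ w, ω.2))
    (by intro ω w; simp only [A1, Prod.mk.injEq, Xpref_iff, Ypref_iff, Upref_iff]
        refine ⟨fun i hi => ?_, fun _ _ => trivial, fun _ _ => trivial⟩
        rw [Function.update_of_ne]; intro h; simp [h] at hi)
    (by intro ω w; simp [Xat])
    (fun ω => qq M n ω * M.pol ⟨n, hn⟩ (ω.2.2 ⟨n, hn⟩) ω.2.1 ω.2.2)
    (fun ω => M.f ⟨n, hn⟩ (ω.1 ⟨n + 1, lt1⟩) (ω.1 ⟨n, lt0⟩) (ω.2.2 ⟨n, hn⟩))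
    (by intro ω w
        have hx : ∀ i : Fin (T + 1), (i : ℕ) < n + 1 →
            Function.update ω.1 ⟨n + 1, lt1⟩ w i = ω.1 i := fun i hi => by
          rw [Function.update_of_ne]; intro h; simp [h] at hi
        dsimp only
        rw [qq_congr M n (Function.update ω.1 ⟨n + 1, lt1⟩ w, ω.2) ω
            hx (fun _ _ => rfl) (fun _ _ => rfl)])
    (by intro ω; simp [M.f_sum])
    (by intro ω ω' h1 h2
        simp only [C, Prod.mk.injEq, Upref_iff, Xat] at h1
        simp only [Xat] at h2
        rw [h1.1, h2, h1.2.2 ⟨n, hn⟩ (by simp)])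
    (by intro ω; rw [P2])
  obtain ⟨P0, E0⟩ := step M.p hp (full T n hn.le) (Uat T n hn) A1
    (fun ω => (Ypref T (n + 1) (by omega) ω, Upref T n hn.le ω)) C
    (by intro ω ω'; simp only [A1, full, Prod.mk.injEq]
        rw [Upref_succ n]; tauto)
    (by intro ω ω'; simp only [C, Prod.mk.injEq]; rw [Upref_succ n]; tauto)
    (by intro ω ω'; simp only [full, Prod.mk.injEq]; tauto)
    (fun ω w => (ω.1, ω.2.1, Function.update ω.2.2 ⟨n, hn⟩ w))
    (by intro ω w; simp only [full, Prod.mk.injEq, Xpref_iff, Ypref_iff, Upref_iff]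
        refine ⟨fun _ _ => trivial, fun _ _ => trivial, fun i hi => ?_⟩
        rw [Function.update_of_ne]; intro h; simp [h] at hi)
    (by intro ω w; simp [Uat])
    (fun ω => qq M n ω)
    (fun ω => M.pol ⟨n, hn⟩ (ω.2.2 ⟨n, hn⟩) ω.2.1 ω.2.2)
    (by intro ω w
        refine qq_congr M n _ ω (fun _ _ => rfl) (fun _ _ => rfl) (fun i hi => ?_)
        dsimp only
        rw [Function.update_of_ne]; intro h; simp [h] at hi)
    (by intro ω
        rw [← M.pol_sum ⟨n, hn⟩ ω.2.1 ω.2.2]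
        refine Finset.sum_congr rfl fun w _ => ?_
        simp only [Function.update_self]
        refine M.pol_causal _ _ _ _ _ _ (fun _ _ => rfl) (fun i hi => ?_)
        rw [Function.update_of_ne]; intro h; simp [h] at hi)
    (by intro ω ω' h1 h2
        simp only [Prod.mk.injEq, Ypref_iff, Upref_iff] at h1
        simp only [Uat] at h2
        rw [h2]
        exact M.pol_causal _ _ _ _ _ _ (fun i hi => h1.1 i (Nat.lt_succ_of_le hi))
          (fun i hi => h1.2 i hi))
    (by intro ω; rw [P1])
  refine ⟨P0, ?_⟩
  have HC : HH M.p (fun ω : Traj T X Y U => (Ypref T (n + 2) (by omega) ω, Upref T (n + 1) hn ω))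
      = HH M.p (fun ω => (Yat T (n + 1) lt1 ω, C ω)) := by
    apply HH_congr
    intro ω ω'; simp only [C, Prod.mk.injEq]; rw [Ypref_succ (n + 1)]; tauto
  simp only [CHMM.condMI, condEnt_eq M hp]
  rw [HC]
  simp only [A1, A2, C, full] at *
  linarith

theorem allP (M : CHMM T X Y U) (n : ℕ) (hn : n ≤ T) :
    ∀ ω, P M.p (full T n hn) ω = qq M n ω := by
  induction hn using Nat.decreasingInduction with
  | self =>
    intro ω
    rw [qq_T]
    unfold P
    have : ∀ ω' : Traj T X Y U, full T T le_rfl ω' = full T T le_rfl ω ↔ ω' = ω := by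
      intro ω'
      refine ⟨fun h => ?_, fun h => by rw [h]⟩
      simp only [full, Prod.mk.injEq, Xpref_iff, Ypref_iff, Upref_iff] at h
      exact Prod.ext (funext fun i => h.1 i i.isLt)
        (Prod.ext (funext fun i => h.2.1 i i.isLt) (funext fun i => h.2.2 i i.isLt))
    simp [this]
  | of_succ k hk ih => exact (level M k hk ih).1

end

end SmootherAux

/-- `H(X^T | Y^T, U^{T-1}) = H(X_0 | Y_0)
  + ∑_{t=1}^{T} [H(X_t | X_{t-1}, Y^{t-1}, U^{t-1}) − I(X_t ; Y_t | Y^{t-1}, U^{t-1})]`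
(the sum over `t = 1, …, T` is indexed by `t = s + 1` for `s : Fin T`). -/
theorem smoother_entropy_entropy_minus_information_gain
    {T : ℕ} {X Y U : Type*} [Fintype X] [Fintype Y] [Fintype U]
    [DecidableEq X] [DecidableEq Y] [DecidableEq U]
    (hT : 1 ≤ T) (M : CHMM T X Y U) :
    M.condEnt (Xpref T (T + 1) le_rfl)
        (fun ω => (Ypref T (T + 1) le_rfl ω, Upref T T le_rfl ω)) =
      M.condEnt (Xat T 0 (by omega)) (Yat T 0 (by omega))
        + ∑ s : Fin T,
          (M.condEnt (Xat T ((s : ℕ) + 1) (by have := s.isLt; omega))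
              (fun ω => (Xat T (s : ℕ) (by have := s.isLt; omega) ω,
                Ypref T ((s : ℕ) + 1) (by have := s.isLt; omega) ω,
                Upref T ((s : ℕ) + 1) (by have := s.isLt; omega) ω))
            - M.condMI (Xat T ((s : ℕ) + 1) (by have := s.isLt; omega))
                (Yat T ((s : ℕ) + 1) (by have := s.isLt; omega))
                (fun ω => (Ypref T ((s : ℕ) + 1) (by have := s.isLt; omega) ω,
                  Upref T ((s : ℕ) + 1) (by have := s.isLt; omega) ω))) := by
  have key := fun (s : Fin T) => (SmootherAux.level M s s.isLt (SmootherAux.allP M _ s.isLt)).2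
  let F : ℕ → ℝ := fun n => if h : n ≤ T then
    M.condEnt (Xpref T (n + 1) (by omega))
        (fun ω => (Ypref T (n + 1) (by omega) ω, Upref T n h ω)) else 0
  have hF : ∀ (n : ℕ) (h : n ≤ T), F n = M.condEnt (Xpref T (n + 1) (by omega))
        (fun ω => (Ypref T (n + 1) (by omega) ω, Upref T n h ω)) := fun n h => dif_pos h
  have hsum : ∑ s : Fin T, (F ((s : ℕ) + 1) - F s) = F T - F 0 := by
    rw [Fin.sum_univ_eq_sum_range (fun n => F (n + 1) - F n), Finset.sum_range_sub]
  have h0 : F 0 = M.condEnt (Xat T 0 (by omega)) (Yat T 0 (by omega)) := by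
    have hp := SmootherAux.p_nonneg M
    rw [hF 0 (by omega), SmootherAux.condEnt_eq M hp, SmootherAux.condEnt_eq M hp]
    congr 1
    · apply SmootherAux.HH_congr
      intro ω ω'
      simp only [Prod.mk.injEq]
      rw [SmootherAux.Xpref_succ 0, SmootherAux.Ypref_succ 0]
      simp [SmootherAux.Xpref_iff, SmootherAux.Ypref_iff, SmootherAux.Upref_iff]
    · apply SmootherAux.HH_congr
      intro ω ω'
      simp only [Prod.mk.injEq]
      rw [SmootherAux.Ypref_succ 0]
      simp [SmootherAux.Ypref_iff, SmootherAux.Upref_iff]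
  rw [← h0, ← hF T le_rfl, ← sub_eq_iff_eq_add', ← hsum]
  refine Finset.sum_congr rfl fun s _ => ?_
  rw [← key s, hF _ s.isLt, hF _ s.isLt.le]
end

section
/- In any controlled hidden Markov model with output-feedback policy over horizon T ≥ 1, given instantaneous cost functions c_t : 𝒳 × 𝒰 → [0, ∞) for 0 ≤ t ≤ T−1 and a weight γ ≥ 0, define for each 0 ≤ t ≤ T−1 and each positive-probability realization (y^{t+1}, u^t) the per-stage reward r̃_t(y^{t+1}, u^t) = h(X_{t+1} | y^{t+1}, u^t) − h(X_{t+1} | y^t, u^t) + h(X_{t+1} | X_t, y^t, u^t). Then the smoothing-averse objective decomposes additively over time: H(X^T | Y^T, U^{T-1}) − γ E[ ∑_{t=0}^{T-1} c_t(X_t, U_t) ] = H(X_0 | Y_0) + ∑_{t=0}^{T-1} E[ r̃_t(Y^{t+1}, U^t) − γ c_t(X_t, U_t) ]. -/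
open Finset

variable {T : ℕ} {X Y U : Type*} [Fintype X] [Fintype Y] [Fintype U]
  [DecidableEq X] [DecidableEq Y] [DecidableEq U]

section Helpers

theorem avg_aux {Ω Z : Type*} [Fintype Ω] [Fintype Z] (upd : Ω → Z → Ω) (get : Ω → Z)
    (h1 : ∀ ω a, get (upd ω a) = a) (h2 : ∀ ω a, upd (upd ω a) (get ω) = ω) (F : Ω → ℝ) :
    (Fintype.card Z : ℝ) * ∑ ω, F ω = ∑ ω, ∑ a, F (upd ω a) := by
  rw [← Fintype.sum_prod_type' (f := fun ω a => F (upd ω a))]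
  have e : (∑ x : Ω × Z, F (upd x.1 x.2)) = ∑ x : Ω × Z, F x.1 := by
    refine Fintype.sum_bijective (fun x : Ω × Z => (upd x.1 x.2, get x.1)) ?_ _ _ (fun x => rfl)
    refine Function.Involutive.bijective ?_
    rintro ⟨ω, a⟩
    simp [h1, h2]
  rw [e, Fintype.sum_prod_type]
  simp [Finset.mul_sum]

theorem sumOut {Ω Z : Type*} [Fintype Ω] [Fintype Z] (upd : Ω → Z → Ω) (get : Ω → Z)
    (h1 : ∀ ω a, get (upd ω a) = a) (h2 : ∀ ω a, upd (upd ω a) (get ω) = ω) (G k K : Ω → ℝ)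
    (hG : ∀ ω a, G (upd ω a) = G ω) (hk : ∀ ω, ∑ a, k (upd ω a) = K ω) :
    (Fintype.card Z : ℝ) * ∑ ω, G ω * k ω = ∑ ω, G ω * K ω := by
  rw [avg_aux upd get h1 h2]
  refine Finset.sum_congr rfl fun ω _ => ?_
  rw [← hk, Finset.mul_sum]
  exact Finset.sum_congr rfl fun a _ => by rw [hG]

/-- agreement of two trajectories up to given times -/
def Ag {T : ℕ} {X Y U : Type*} (nx ny nu : ℕ) (ω ω' : Traj T X Y U) : Prop :=
  (∀ i : Fin (T + 1), (i : ℕ) < nx → ω.1 i = ω'.1 i) ∧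
  (∀ i : Fin (T + 1), (i : ℕ) < ny → ω.2.1 i = ω'.2.1 i) ∧
  (∀ i : Fin T, (i : ℕ) < nu → ω.2.2 i = ω'.2.2 i)

/-- `φ` depends only on the given prefixes -/
def Dep {T : ℕ} {X Y U β : Type*} (nx ny nu : ℕ) (φ : Traj T X Y U → β) : Prop :=
  ∀ ω ω', Ag nx ny nu ω ω' → φ ω = φ ω'

theorem Ag.mono {T : ℕ} {X Y U : Type*} {a b c a' b' c' : ℕ} {ω ω' : Traj T X Y U}
    (h : Ag a b c ω ω') (ha : a' ≤ a) (hb : b' ≤ b) (hc : c' ≤ c) : Ag a' b' c' ω ω' :=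
  ⟨fun i hi => h.1 i (by omega), fun i hi => h.2.1 i (by omega), fun i hi => h.2.2 i (by omega)⟩

theorem Dep.mono {T : ℕ} {X Y U β : Type*} {a b c a' b' c' : ℕ} {φ : Traj T X Y U → β}
    (h : Dep a b c φ) (ha : a ≤ a') (hb : b ≤ b') (hc : c ≤ c') : Dep a' b' c' φ :=
  fun ω ω' hh => h ω ω' (hh.mono ha hb hc)

theorem Dep.mul {T : ℕ} {X Y U : Type*} {a b c : ℕ} {φ ψ : Traj T X Y U → ℝ}
    (h : Dep a b c φ) (h' : Dep a b c ψ) : Dep a b c (fun ω => φ ω * ψ ω) :=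
  fun ω ω' hh => by simp only [h ω ω' hh, h' ω ω' hh]

section
variable {T : ℕ} {X Y U : Type*} [Fintype X] [Fintype Y] [Fintype U]
  (M : CHMM T X Y U)

/-- partial product of the trajectory mass -/
noncomputable def CHMM.q (n : ℕ) (ω : Traj T X Y U) : ℝ :=
  M.p0 (ω.1 0) * M.g0 (ω.2.1 0) (ω.1 0) *
    ∏ t ∈ (Finset.univ : Finset (Fin T)).filter (fun t : Fin T => (t : ℕ) < n),
      (M.pol t (ω.2.2 t) ω.2.1 ω.2.2 *
        M.f t (ω.1 t.succ) (ω.1 t.castSucc) (ω.2.2 t) *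
        M.g t (ω.2.1 t.succ) (ω.1 t.succ) (ω.2.2 t))

/-- policy factor -/
noncomputable def CHMM.kU (t : Fin T) (a : U) (ω : Traj T X Y U) : ℝ :=
  M.pol t a ω.2.1 ω.2.2
/-- transition factor -/
noncomputable def CHMM.kX (t : Fin T) (a : X) (ω : Traj T X Y U) : ℝ :=
  M.f t a (ω.1 t.castSucc) (ω.2.2 t)
/-- measurement factor -/
noncomputable def CHMM.kY (t : Fin T) (a : Y) (ω : Traj T X Y U) : ℝ :=
  M.g t a (ω.1 t.succ) (ω.2.2 t)

theorem CHMM.q_T : M.q T = M.p := by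
  funext ω
  simp [CHMM.q, CHMM.p]

theorem CHMM.q_succ (t : Fin T) (ω : Traj T X Y U) :
    M.q (t + 1) ω = M.q t ω * M.kU t (ω.2.2 t) ω * M.kX t (ω.1 t.succ) ω *
      M.kY t (ω.2.1 t.succ) ω := by
  have : (Finset.univ : Finset (Fin T)).filter (fun s : Fin T => (s : ℕ) < t + 1)
      = insert t ((Finset.univ : Finset (Fin T)).filter (fun s : Fin T => (s : ℕ) < t)) := by
    ext s
    simp only [Finset.mem_filter, Finset.mem_univ, true_and, Finset.mem_insert, Fin.ext_iff]
    omega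
  rw [CHMM.q, this, Finset.prod_insert (by simp), CHMM.q, CHMM.kU, CHMM.kX, CHMM.kY]
  ring

theorem CHMM.dep_kU (t : Fin T) (a : U) : Dep 0 (t + 1) t (M.kU t a) := by
  intro ω ω' h
  exact M.pol_causal t a _ _ _ _ (fun i hi => h.2.1 i (by omega)) (fun i hi => h.2.2 i hi)

theorem CHMM.dep_kX (t : Fin T) (a : X) : Dep (t + 1) 0 (t + 1) (M.kX t a) := by
  intro ω ω' h
  simp only [CHMM.kX]
  rw [h.1 t.castSucc (by simp), h.2.2 t (by simp)]

theorem CHMM.dep_kY (t : Fin T) (a : Y) : Dep (t + 2) 0 (t + 1) (M.kY t a) := by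
  intro ω ω' h
  simp only [CHMM.kY]
  rw [h.1 t.succ (by simp), h.2.2 t (by simp)]

theorem CHMM.dep_kU' (t : Fin T) :
    Dep 0 (t + 1) (t + 1) (fun ω : Traj T X Y U => M.kU t (ω.2.2 t) ω) := by
  intro ω ω' h
  simp only
  rw [h.2.2 t (by simp)]
  exact M.dep_kU t _ _ _ (h.mono le_rfl le_rfl (by simp))

theorem CHMM.dep_kX' (t : Fin T) :
    Dep (t + 2) 0 (t + 1) (fun ω : Traj T X Y U => M.kX t (ω.1 t.succ) ω) := by
  intro ω ω' h
  simp only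
  rw [h.1 t.succ (by simp)]
  exact M.dep_kX t _ _ _ (h.mono (by simp) le_rfl le_rfl)

theorem CHMM.dep_kY' (t : Fin T) :
    Dep (t + 2) (t + 2) (t + 1) (fun ω : Traj T X Y U => M.kY t (ω.2.1 t.succ) ω) := by
  intro ω ω' h
  simp only
  rw [h.2.1 t.succ (by simp)]
  exact M.dep_kY t _ _ _ (h.mono le_rfl (by simp) le_rfl)

theorem CHMM.dep_q (n : ℕ) : Dep (n + 1) (n + 1) n (M.q n) := by
  intro ω ω' h
  unfold CHMM.q
  rw [h.1 0 (by simp), h.2.1 0 (by simp)]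
  congr 1
  refine Finset.prod_congr rfl fun t ht => ?_
  have ht : (t : ℕ) < n := by simpa using ht
  have e1 := M.dep_kU' t ω ω' (h.mono (by omega) (by omega) (by omega))
  have e2 := M.dep_kX' t ω ω' (h.mono (by omega) (by omega) (by omega))
  have e3 := M.dep_kY' t ω ω' (h.mono (by omega) (by omega) (by omega))
  simp only [CHMM.kU, CHMM.kX, CHMM.kY] at e1 e2 e3
  rw [e1, e2, e3]

theorem CHMM.outY (t : Fin T) {a c : ℕ} (G : Traj T X Y U → ℝ) (hG : Dep a (t + 1) c G)
    (w : Y → ℝ) :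
    (Fintype.card Y : ℝ) * ∑ ω : Traj T X Y U, G ω * (w (ω.2.1 t.succ) * M.kY t (ω.2.1 t.succ) ω)
      = ∑ ω, G ω * ∑ b, w b * M.kY t b ω := by
  refine sumOut (fun (ω : Traj T X Y U) b => (ω.1, Function.update ω.2.1 t.succ b, ω.2.2))
    (fun ω : Traj T X Y U => ω.2.1 t.succ) (by simp) (by simp) _ _ _ ?_ ?_
  · intro ω b
    refine hG _ _ ⟨fun i _ => rfl, fun i hi => ?_, fun i _ => rfl⟩
    refine Function.update_of_ne ?_ _ _
    rintro rfl
    simp at hi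
  · intro ω
    simp [CHMM.kY]

theorem CHMM.outX (t : Fin T) {b c : ℕ} (G : Traj T X Y U → ℝ) (hG : Dep (t + 1) b c G)
    (w : X → ℝ) :
    (Fintype.card X : ℝ) * ∑ ω : Traj T X Y U, G ω * (w (ω.1 t.succ) * M.kX t (ω.1 t.succ) ω)
      = ∑ ω, G ω * ∑ b, w b * M.kX t b ω := by
  refine sumOut (fun (ω : Traj T X Y U) b => (Function.update ω.1 t.succ b, ω.2.1, ω.2.2))
    (fun ω : Traj T X Y U => ω.1 t.succ) (by simp) (by simp) _ _ _ ?_ ?_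
  · intro ω b
    refine hG _ _ ⟨fun i hi => ?_, fun i _ => rfl, fun i _ => rfl⟩
    refine Function.update_of_ne ?_ _ _
    rintro rfl
    simp at hi
  · intro ω
    refine Finset.sum_congr rfl fun b _ => ?_
    simp only [Function.update_self]
    congr 1
    refine M.dep_kX t b _ _ ⟨fun i hi => ?_, fun i _ => rfl, fun i _ => rfl⟩
    refine Function.update_of_ne ?_ _ _
    rintro rfl
    simp at hi

theorem CHMM.outU (t : Fin T) {a b : ℕ} (G : Traj T X Y U → ℝ) (hG : Dep a b t G)
    (w : U → ℝ) :
    (Fintype.card U : ℝ) * ∑ ω : Traj T X Y U, G ω * (w (ω.2.2 t) * M.kU t (ω.2.2 t) ω)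
      = ∑ ω, G ω * ∑ b, w b * M.kU t b ω := by
  refine sumOut (fun (ω : Traj T X Y U) b => (ω.1, ω.2.1, Function.update ω.2.2 t b))
    (fun ω : Traj T X Y U => ω.2.2 t) (by simp) (by simp) _ _ _ ?_ ?_
  · intro ω b
    refine hG _ _ ⟨fun i _ => rfl, fun i _ => rfl, fun i hi => ?_⟩
    refine Function.update_of_ne ?_ _ _
    rintro rfl
    simp at hi
  · intro ω
    refine Finset.sum_congr rfl fun b _ => ?_
    simp only [Function.update_self]
    congr 1
    refine M.dep_kU t b _ _ ⟨fun i _ => rfl, fun i _ => rfl, fun i hi => ?_⟩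
    refine Function.update_of_ne ?_ _ _
    rintro rfl
    simp at hi

theorem CHMM.kU_sum (t : Fin T) (ω : Traj T X Y U) : ∑ b, (fun _ => (1:ℝ)) b * M.kU t b ω = 1 := by
  simp [CHMM.kU, M.pol_sum]
theorem CHMM.kX_sum (t : Fin T) (ω : Traj T X Y U) : ∑ b, (fun _ => (1:ℝ)) b * M.kX t b ω = 1 := by
  simp [CHMM.kX, M.f_sum]
theorem CHMM.kY_sum (t : Fin T) (ω : Traj T X Y U) : ∑ b, (fun _ => (1:ℝ)) b * M.kY t b ω = 1 := by
  simp [CHMM.kY, M.g_sum]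

theorem CHMM.stepY (t : Fin T) (φ : Traj T X Y U → ℝ) (hφ : Dep (t + 2) (t + 1) (t + 1) φ)
    (w : Y → ℝ) :
    (Fintype.card Y : ℝ) * ∑ ω : Traj T X Y U, φ ω * w (ω.2.1 t.succ) * M.q (t + 1) ω
      = ∑ ω : Traj T X Y U, φ ω * (∑ b, w b * M.kY t b ω) *
          (M.q t ω * M.kU t (ω.2.2 t) ω * M.kX t (ω.1 t.succ) ω) := by
  have h := M.outY t (a := t + 2) (c := t + 1)
    (fun ω => φ ω * (M.q t ω * M.kU t (ω.2.2 t) ω * M.kX t (ω.1 t.succ) ω))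
    (hφ.mul ((((M.dep_q t).mono (by omega) (by omega) (by omega)).mul
      ((M.dep_kU' t).mono (by omega) (by omega) (by omega))).mul
      ((M.dep_kX' t).mono (by omega) (by omega) (by omega)))) w
  calc _ = _ := by
        congr 1
        refine Finset.sum_congr rfl fun ω _ => ?_
        rw [M.q_succ]
        ring
    _ = _ := h
    _ = _ := Finset.sum_congr rfl fun ω _ => by ring

theorem CHMM.stepX (t : Fin T) (φ : Traj T X Y U → ℝ) (hφ : Dep (t + 1) (t + 1) (t + 1) φ)
    (w : X → ℝ) :
    (Fintype.card X : ℝ) * ((Fintype.card Y : ℝ) *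
        ∑ ω : Traj T X Y U, φ ω * w (ω.1 t.succ) * M.q (t + 1) ω)
      = ∑ ω : Traj T X Y U, φ ω * (∑ b, w b * M.kX t b ω) * (M.q t ω * M.kU t (ω.2.2 t) ω) := by
  have h0 := M.stepY t (fun ω => φ ω * w (ω.1 t.succ))
    ((hφ.mono (by omega) le_rfl le_rfl).mul
      (fun ω ω' h => by rw [h.1 t.succ (by simp)])) (fun _ => 1)
  simp only [M.kY_sum, mul_one] at h0
  rw [h0]
  have h := M.outX t (b := t + 1) (c := t + 1)
    (fun ω => φ ω * (M.q t ω * M.kU t (ω.2.2 t) ω))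
    (hφ.mul (((M.dep_q t).mono (by omega) (by omega) (by omega)).mul
      ((M.dep_kU' t).mono (by omega) (by omega) (by omega)))) w
  calc _ = _ := by
        congr 1
        refine Finset.sum_congr rfl fun ω _ => ?_
        ring
    _ = _ := h
    _ = _ := Finset.sum_congr rfl fun ω _ => by ring

theorem CHMM.stepU (t : Fin T) (φ : Traj T X Y U → ℝ) (hφ : Dep (t + 1) (t + 1) t φ)
    (w : U → ℝ) :
    (Fintype.card U : ℝ) * ((Fintype.card X : ℝ) * ((Fintype.card Y : ℝ) *
        ∑ ω : Traj T X Y U, φ ω * w (ω.2.2 t) * M.q (t + 1) ω))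
      = ∑ ω : Traj T X Y U, φ ω * (∑ b, w b * M.kU t b ω) * M.q t ω := by
  have h0 := M.stepX t (fun ω => φ ω * w (ω.2.2 t))
    ((hφ.mono (by omega) le_rfl (by omega)).mul
      (fun ω ω' h => by rw [h.2.2 t (by simp)])) (fun _ => 1)
  simp only [M.kX_sum, mul_one] at h0
  rw [h0]
  have h := M.outU t (a := t + 1) (b := t + 1) (fun ω => φ ω * M.q t ω)
    (hφ.mul ((M.dep_q t).mono (by omega) (by omega) (by omega))) w
  calc _ = _ := by
        congr 1
        refine Finset.sum_congr rfl fun ω _ => ?_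
        ring
    _ = _ := h
    _ = _ := Finset.sum_congr rfl fun ω _ => by ring

theorem CHMM.expect_q (k : ℕ) : ∀ (n : ℕ), n + k = T → ∀ φ : Traj T X Y U → ℝ,
    Dep (n + 1) (n + 1) n φ →
    ((Fintype.card U : ℝ) * ((Fintype.card X : ℝ) * (Fintype.card Y : ℝ))) ^ k *
      ∑ ω, φ ω * M.p ω = ∑ ω, φ ω * M.q n ω := by
  induction k with
  | zero =>
    intro n hn φ _
    obtain rfl : n = T := by omega
    simp [M.q_T]
  | succ k ih =>
    intro n hn φ hφ
    have h1 := ih (n + 1) (by omega) φ (hφ.mono (by omega) (by omega) (by omega))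
    have h2 := M.stepU ⟨n, by omega⟩ φ hφ (fun _ => 1)
    simp only [M.kU_sum, mul_one] at h2
    rw [← h2, ← h1]
    ring

theorem CHMM.kernU [Nonempty X] [Nonempty Y] [Nonempty U]
    (t : Fin T) (φ : Traj T X Y U → ℝ) (hφ : Dep (t + 1) (t + 1) t φ) (w : U → ℝ) :
    ∑ ω : Traj T X Y U, φ ω * w (ω.2.2 t) * M.p ω
      = ∑ ω : Traj T X Y U, φ ω * (∑ b, w b * M.kU t b ω) * M.p ω := by
  have ht := t.isLt
  have hw : Dep (t + 1) (t + 1) t (fun ω : Traj T X Y U => ∑ b, w b * M.kU t b ω) :=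
    fun ω ω' h => Finset.sum_congr rfl fun b _ => by
      rw [M.dep_kU t b ω ω' (h.mono (by omega) le_rfl le_rfl)]
  have h1 := M.expect_q (T - t - 1) (t + 1) (by omega) (fun ω => φ ω * w (ω.2.2 t))
    ((hφ.mono (by omega) (by omega) (by omega)).mul
      (fun ω ω' h => by rw [h.2.2 t (by simp)]))
  have h2 := M.expect_q (T - t - 1 + 1) t (by omega) _ (hφ.mul hw)
  have h3 := M.stepU t φ hφ w
  rw [← h2, ← h1, pow_succ] at h3
  have cU : (0:ℝ) < Fintype.card U := by exact_mod_cast Fintype.card_pos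
  have cX : (0:ℝ) < Fintype.card X := by exact_mod_cast Fintype.card_pos
  have cY : (0:ℝ) < Fintype.card Y := by exact_mod_cast Fintype.card_pos
  refine mul_left_cancel₀ (a := (((Fintype.card U : ℝ) * ((Fintype.card X : ℝ) *
    (Fintype.card Y : ℝ))) ^ (T - t - 1) * ((Fintype.card U : ℝ) * ((Fintype.card X : ℝ) *
    (Fintype.card Y : ℝ))))) (by positivity) ?_
  rw [← h3]
  ring

theorem CHMM.kernX [Nonempty X] [Nonempty Y] [Nonempty U]
    (t : Fin T) (φ : Traj T X Y U → ℝ) (hφ : Dep (t + 1) (t + 1) (t + 1) φ) (w : X → ℝ) :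
    ∑ ω : Traj T X Y U, φ ω * w (ω.1 t.succ) * M.p ω
      = ∑ ω : Traj T X Y U, φ ω * (∑ b, w b * M.kX t b ω) * M.p ω := by
  have ht := t.isLt
  have hw : Dep (t + 1) (t + 1) (t + 1) (fun ω : Traj T X Y U => ∑ b, w b * M.kX t b ω) :=
    fun ω ω' h => Finset.sum_congr rfl fun b _ => by
      rw [M.dep_kX t b ω ω' (h.mono le_rfl (by omega) le_rfl)]
  have h1 := M.expect_q (T - t - 1) (t + 1) (by omega) (fun ω => φ ω * w (ω.1 t.succ))
    ((hφ.mono (by omega) (by omega) (by omega)).mul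
      (fun ω ω' h => by rw [h.1 t.succ (by simp)]))
  have h2 := M.expect_q (T - t - 1) (t + 1) (by omega) _
    ((hφ.mul hw).mono (by omega) (by omega) (by omega))
  have h3 := M.stepX t φ hφ w
  have h4 := M.stepX t _ (hφ.mul hw) (fun _ => 1)
  simp only [M.kX_sum, mul_one] at h4
  rw [← h4, ← h2, ← h1] at h3
  have cU : (0:ℝ) < Fintype.card U := by exact_mod_cast Fintype.card_pos
  have cX : (0:ℝ) < Fintype.card X := by exact_mod_cast Fintype.card_pos
  have cY : (0:ℝ) < Fintype.card Y := by exact_mod_cast Fintype.card_pos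
  exact mul_left_cancel₀ (by positivity) (mul_left_cancel₀ cY.ne' (mul_left_cancel₀ cX.ne' h3))

theorem CHMM.kernY [Nonempty X] [Nonempty Y] [Nonempty U]
    (t : Fin T) (φ : Traj T X Y U → ℝ) (hφ : Dep (t + 2) (t + 1) (t + 1) φ) (w : Y → ℝ) :
    ∑ ω : Traj T X Y U, φ ω * w (ω.2.1 t.succ) * M.p ω
      = ∑ ω : Traj T X Y U, φ ω * (∑ b, w b * M.kY t b ω) * M.p ω := by
  have ht := t.isLt
  have hw : Dep (t + 2) (t + 1) (t + 1) (fun ω : Traj T X Y U => ∑ b, w b * M.kY t b ω) :=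
    fun ω ω' h => Finset.sum_congr rfl fun b _ => by
      rw [M.dep_kY t b ω ω' (h.mono le_rfl (by omega) le_rfl)]
  have h1 := M.expect_q (T - t - 1) (t + 1) (by omega) (fun ω => φ ω * w (ω.2.1 t.succ))
    ((hφ.mono (by omega) (by omega) (by omega)).mul
      (fun ω ω' h => by rw [h.2.1 t.succ (by simp)]))
  have h2 := M.expect_q (T - t - 1) (t + 1) (by omega) _
    ((hφ.mul hw).mono (by omega) (by omega) (by omega))
  have h3 := M.stepY t φ hφ w
  have h4 := M.stepY t _ (hφ.mul hw) (fun _ => 1)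
  simp only [M.kY_sum, mul_one] at h4
  rw [← h4, ← h2, ← h1] at h3
  have cU : (0:ℝ) < Fintype.card U := by exact_mod_cast Fintype.card_pos
  have cX : (0:ℝ) < Fintype.card X := by exact_mod_cast Fintype.card_pos
  have cY : (0:ℝ) < Fintype.card Y := by exact_mod_cast Fintype.card_pos
  exact mul_left_cancel₀ (by positivity) (mul_left_cancel₀ cY.ne' h3)

open Classical in
/-- probability of an event -/
noncomputable def CHMM.PP (R : Traj T X Y U → Prop) : ℝ :=
  ∑ ω, if R ω then M.p ω else 0

theorem CHMM.PP_congr {R R' : Traj T X Y U → Prop} (h : ∀ ω, R ω ↔ R' ω) : M.PP R = M.PP R' := by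
  rw [show R = R' from funext fun ω => propext (h ω)]

theorem CHMM.PP_U (ω₀ : Traj T X Y U) (t : Fin T) (R : Traj T X Y U → Prop)
    (hR : Dep (t + 1) (t + 1) t R) (hk : ∀ ω, R ω → Ag 0 (t + 1) t ω ω₀) :
    M.PP (fun ω => R ω ∧ ω.2.2 t = ω₀.2.2 t) = M.kU t (ω₀.2.2 t) ω₀ * M.PP R := by
  classical
  have : Nonempty X := ⟨ω₀.1 0⟩
  have : Nonempty Y := ⟨ω₀.2.1 0⟩
  have : Nonempty U := ⟨ω₀.2.2 t⟩
  have h := M.kernU t (fun ω => if R ω then 1 else 0)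
    (fun ω ω' h => by simp only [hR ω ω' h]) (fun b => if b = ω₀.2.2 t then 1 else 0)
  unfold CHMM.PP
  rw [Finset.mul_sum]
  calc _ = _ := Finset.sum_congr rfl fun ω _ => by
          by_cases h1 : R ω <;> by_cases h2 : ω.2.2 t = ω₀.2.2 t <;> simp [h1, h2]
    _ = _ := h
    _ = _ := Finset.sum_congr rfl fun ω _ => by
          by_cases h1 : R ω
          · simp [h1, M.dep_kU t _ ω ω₀ (hk ω h1)]
          · simp [h1]

theorem CHMM.PP_X (ω₀ : Traj T X Y U) (t : Fin T) (R : Traj T X Y U → Prop)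
    (hR : Dep (t + 1) (t + 1) (t + 1) R)
    (hk : ∀ ω, R ω → ω.1 t.castSucc = ω₀.1 t.castSucc ∧ ω.2.2 t = ω₀.2.2 t) :
    M.PP (fun ω => R ω ∧ ω.1 t.succ = ω₀.1 t.succ) = M.kX t (ω₀.1 t.succ) ω₀ * M.PP R := by
  classical
  have : Nonempty X := ⟨ω₀.1 0⟩
  have : Nonempty Y := ⟨ω₀.2.1 0⟩
  have : Nonempty U := ⟨ω₀.2.2 t⟩
  have h := M.kernX t (fun ω => if R ω then 1 else 0)
    (fun ω ω' h => by simp only [hR ω ω' h]) (fun b => if b = ω₀.1 t.succ then 1 else 0)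
  unfold CHMM.PP
  rw [Finset.mul_sum]
  calc _ = _ := Finset.sum_congr rfl fun ω _ => by
          by_cases h1 : R ω <;> by_cases h2 : ω.1 t.succ = ω₀.1 t.succ <;> simp [h1, h2]
    _ = _ := h
    _ = _ := Finset.sum_congr rfl fun ω _ => by
          by_cases h1 : R ω
          · simp [h1, CHMM.kX, hk ω h1]
          · simp [h1]

theorem CHMM.PP_Y (ω₀ : Traj T X Y U) (t : Fin T) (R : Traj T X Y U → Prop)
    (hR : Dep (t + 2) (t + 1) (t + 1) R)
    (hk : ∀ ω, R ω → ω.1 t.succ = ω₀.1 t.succ ∧ ω.2.2 t = ω₀.2.2 t) :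
    M.PP (fun ω => R ω ∧ ω.2.1 t.succ = ω₀.2.1 t.succ) = M.kY t (ω₀.2.1 t.succ) ω₀ * M.PP R := by
  classical
  have : Nonempty X := ⟨ω₀.1 0⟩
  have : Nonempty Y := ⟨ω₀.2.1 0⟩
  have : Nonempty U := ⟨ω₀.2.2 t⟩
  have h := M.kernY t (fun ω => if R ω then 1 else 0)
    (fun ω ω' h => by simp only [hR ω ω' h]) (fun b => if b = ω₀.2.1 t.succ then 1 else 0)
  unfold CHMM.PP
  rw [Finset.mul_sum]
  calc _ = _ := Finset.sum_congr rfl fun ω _ => by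
          by_cases h1 : R ω <;> by_cases h2 : ω.2.1 t.succ = ω₀.2.1 t.succ <;> simp [h1, h2]
    _ = _ := h
    _ = _ := Finset.sum_congr rfl fun ω _ => by
          by_cases h1 : R ω
          · simp [h1, CHMM.kY, hk ω h1]
          · simp [h1]

theorem CHMM.p_nonneg (ω : Traj T X Y U) : 0 ≤ M.p ω := by
  unfold CHMM.p
  refine mul_nonneg (mul_nonneg (M.p0_nonneg _) (M.g0_nonneg _ _)) (Finset.prod_nonneg fun t _ => ?_)
  exact mul_nonneg (mul_nonneg (M.pol_nonneg _ _ _ _) (M.f_nonneg _ _ _ _)) (M.g_nonneg _ _ _ _)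

theorem CHMM.PP_pos (ω : Traj T X Y U) (h : 0 < M.p ω) (R : Traj T X Y U → Prop) (hR : R ω) :
    0 < M.PP R := by
  classical
  refine Finset.sum_pos' (fun ω' _ => ?_) ⟨ω, Finset.mem_univ _, by simp [hR, h]⟩
  split_ifs
  · exact M.p_nonneg _
  · exact le_rfl

/-- expected log-probability of the class of `ω` -/
noncomputable def CHMM.LL (R : Traj T X Y U → Traj T X Y U → Prop) : ℝ :=
  ∑ ω, M.p ω * Real.log (M.PP (fun ω' => R ω' ω))

theorem CHMM.LL_congr {R R' : Traj T X Y U → Traj T X Y U → Prop}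
    (h : ∀ ω ω', R ω ω' ↔ R' ω ω') : M.LL R = M.LL R' := by
  rw [show R = R' from funext fun ω => funext fun ω' => propext (h ω ω')]

theorem CHMM.prob_eq {α : Type*} [DecidableEq α] (A : Traj T X Y U → α) (a : α) :
    M.prob A a = M.PP (fun ω => A ω = a) := by
  classical
  unfold CHMM.prob CHMM.PP
  refine Finset.sum_congr rfl fun ω _ => ?_
  by_cases h : A ω = a <;> simp [h]

theorem CHMM.prob_nonneg {α : Type*} [DecidableEq α] (A : Traj T X Y U → α) (a : α) :
    0 ≤ M.prob A a := by
  refine Finset.sum_nonneg fun ω _ => ?_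
  split_ifs
  · exact M.p_nonneg _
  · exact le_rfl

theorem CHMM.sum_prob {α : Type*} [Fintype α] [DecidableEq α] (A : Traj T X Y U → α) (G : α → ℝ) :
    ∑ a, M.prob A a * G a = ∑ ω, M.p ω * G (A ω) := by
  simp only [CHMM.prob, Finset.sum_mul]
  rw [Finset.sum_comm]
  refine Finset.sum_congr rfl fun ω _ => ?_
  simp [ite_mul]

theorem CHMM.prob_le {α β : Type*} [DecidableEq α] [DecidableEq β] (A : Traj T X Y U → α)
    (B : Traj T X Y U → β) (a : α) (b : β) (h : ∀ ω, A ω = a → B ω = b) :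
    M.prob A a ≤ M.prob B b := by
  refine Finset.sum_le_sum fun ω _ => ?_
  by_cases h1 : A ω = a
  · simp [h1, h ω h1]
  · rw [if_neg h1]
    split_ifs
    · exact M.p_nonneg _
    · exact le_rfl

theorem CHMM.LL_sub {α β : Type*} [DecidableEq α] [DecidableEq β]
    (A : Traj T X Y U → α) (B : Traj T X Y U → β) :
    -∑ ω, M.p ω * Real.log (M.prob A (A ω) / M.prob B (B ω))
      = M.LL (fun ω ω' => B ω = B ω') - M.LL (fun ω ω' => A ω = A ω') := by
  unfold CHMM.LL
  rw [← Finset.sum_sub_distrib, ← Finset.sum_neg_distrib]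
  refine Finset.sum_congr rfl fun ω _ => ?_
  rcases (M.p_nonneg ω).eq_or_lt with h | h
  · simp [← h]
  · rw [M.prob_eq, M.prob_eq, Real.log_div (M.PP_pos ω h (fun ω' => A ω' = A ω) rfl).ne'
      (M.PP_pos ω h (fun ω' => B ω' = B ω) rfl).ne']
    ring

theorem CHMM.condEnt_LL {α β : Type*} [Fintype α] [DecidableEq α] [Fintype β] [DecidableEq β]
    (A : Traj T X Y U → α) (B : Traj T X Y U → β) :
    M.condEnt A B = M.LL (fun ω ω' => B ω = B ω') -
      M.LL (fun ω ω' => A ω = A ω' ∧ B ω = B ω') := by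
  have h := M.sum_prob (fun ω => (A ω, B ω))
    (fun x => Real.log (M.prob (fun ω => (A ω, B ω)) x / M.prob B x.2))
  rw [Fintype.sum_prod_type] at h
  unfold CHMM.condEnt
  rw [h, M.LL_sub (fun ω => (A ω, B ω)) B]
  simp only [Prod.mk.injEq]

theorem CHMM.pcondEnt_LL {α β : Type*} [Fintype α] [DecidableEq α] [Fintype β] [DecidableEq β]
    (A : Traj T X Y U → α) (B : Traj T X Y U → β) :
    ∑ ω, M.p ω * M.pcondEnt A B (B ω) = M.LL (fun ω ω' => B ω = B ω') -
      M.LL (fun ω ω' => A ω = A ω' ∧ B ω = B ω') := by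
  rw [← M.condEnt_LL, ← M.sum_prob B (M.pcondEnt A B)]
  unfold CHMM.condEnt CHMM.pcondEnt CHMM.cprob
  rw [Finset.sum_comm, ← Finset.sum_neg_distrib]
  refine Finset.sum_congr rfl fun b _ => ?_
  rw [mul_neg, Finset.mul_sum]
  congr 1
  refine Finset.sum_congr rfl fun a _ => ?_
  have h1 := M.prob_le (fun ω => (A ω, B ω)) B (a, b) b (fun ω h => (Prod.mk.inj h).2)
  have h2 := M.prob_nonneg (fun ω => (A ω, B ω)) (a, b)
  by_cases h0 : M.prob B b = 0
  · have : M.prob (fun ω => (A ω, B ω)) (a, b) = 0 := by linarith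
    simp [this]
  · field_simp

theorem CHMM.pcondEnt2_LL {α α' β : Type*} [Fintype α] [DecidableEq α] [Fintype α']
    [DecidableEq α'] [Fintype β] [DecidableEq β]
    (A : Traj T X Y U → α) (A' : Traj T X Y U → α') (B : Traj T X Y U → β) :
    ∑ ω, M.p ω * M.pcondEnt2 A A' B (B ω) = M.LL (fun ω ω' => A' ω = A' ω' ∧ B ω = B ω') -
      M.LL (fun ω ω' => A ω = A ω' ∧ A' ω = A' ω' ∧ B ω = B ω') := by
  have h := M.condEnt_LL A (fun ω => (A' ω, B ω))
  simp only [Prod.mk.injEq] at h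
  rw [← h, ← M.sum_prob B (M.pcondEnt2 A A' B)]
  unfold CHMM.condEnt CHMM.pcondEnt2 CHMM.cprob
  simp only [Fintype.sum_prod_type, mul_neg, Finset.mul_sum, Finset.sum_neg_distrib]
  congr 1
  rw [Finset.sum_comm]
  refine Finset.sum_congr rfl fun a _ => ?_
  rw [Finset.sum_comm]
  refine Finset.sum_congr rfl fun a' _ => ?_
  refine Finset.sum_congr rfl fun b _ => ?_
  have e : M.prob (fun ω => ((A ω, A' ω), B ω)) ((a, a'), b)
      = M.prob (fun ω => (A ω, (A' ω, B ω))) (a, (a', b)) := by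
    rw [M.prob_eq, M.prob_eq]
    refine M.PP_congr fun ω => ?_
    simp only [Prod.mk.injEq, and_assoc]
  rw [e]
  have h1 := M.prob_le (fun ω => (A ω, (A' ω, B ω))) B (a, (a', b)) b
    (fun ω h => (Prod.mk.inj (Prod.mk.inj h).2).2)
  have h2 := M.prob_nonneg (fun ω => (A ω, (A' ω, B ω))) (a, (a', b))
  by_cases h0 : M.prob B b = 0
  · have : M.prob (fun ω => (A ω, (A' ω, B ω))) (a, (a', b)) = 0 := by linarith
    simp [this]
  · field_simp

end

theorem pref_iff {Z : Type*} {N n : ℕ} (h : n ≤ N) (v v' : Fin N → Z) :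
    ((fun i => v (Fin.castLE h i)) = fun i => v' (Fin.castLE h i)) ↔
      ∀ i : Fin N, (i : ℕ) < n → v i = v' i := by
  constructor
  · intro e i hi
    exact congrFun e ⟨i, hi⟩
  · intro e
    funext i
    exact e _ i.isLt

/-- agreement of the first `n` entries -/
def AgV {Z : Type*} {N : ℕ} (n : ℕ) (v v' : Fin N → Z) : Prop :=
  ∀ i : Fin N, (i : ℕ) < n → v i = v' i

theorem AgV.succ_iff {Z : Type*} {N : ℕ} (n : ℕ) (k : Fin N) (hk : (k : ℕ) = n) (v v' : Fin N → Z) :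
    AgV (n + 1) v v' ↔ AgV n v v' ∧ v k = v' k := by
  constructor
  · intro h
    exact ⟨fun i hi => h i (by omega), h k (by omega)⟩
  · rintro ⟨h1, h2⟩ i hi
    by_cases hh : (i : ℕ) < n
    · exact h1 i hh
    · obtain rfl : i = k := Fin.ext (by omega)
      exact h2

theorem AgV.congr {Z : Type*} {N n m : ℕ} {v w z : Fin N → Z} (h : AgV n v w) (hm : m ≤ n) :
    AgV m v z ↔ AgV m w z :=
  ⟨fun h' i hi => (h i (by omega)).symm.trans (h' i hi),
   fun h' i hi => (h i (by omega)).trans (h' i hi)⟩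

section
variable {T : ℕ} {X Y U : Type*} [Fintype X] [Fintype Y] [Fintype U]
  (M : CHMM T X Y U)

/-- The telescoping quantity `H(X^n | Y^n, U^{n-1})`. -/
noncomputable def CHMM.DD (n : ℕ) : ℝ :=
  M.LL (fun ω ω' => AgV (n + 1) ω.2.1 ω'.2.1 ∧ AgV n ω.2.2 ω'.2.2) -
  M.LL (fun ω ω' => AgV (n + 1) ω.1 ω'.1 ∧ AgV (n + 1) ω.2.1 ω'.2.1 ∧ AgV n ω.2.2 ω'.2.2)

theorem CHMM.DD_succ (t : Fin T) : M.DD (t + 1) - M.DD t =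
    (M.LL (fun ω ω' => AgV (t + 2) ω.2.1 ω'.2.1 ∧ AgV (t + 1) ω.2.2 ω'.2.2) -
     M.LL (fun ω ω' => ω.1 t.succ = ω'.1 t.succ ∧
        AgV (t + 2) ω.2.1 ω'.2.1 ∧ AgV (t + 1) ω.2.2 ω'.2.2))
    - (M.LL (fun ω ω' => AgV (t + 1) ω.2.1 ω'.2.1 ∧ AgV (t + 1) ω.2.2 ω'.2.2) -
     M.LL (fun ω ω' => ω.1 t.succ = ω'.1 t.succ ∧
        AgV (t + 1) ω.2.1 ω'.2.1 ∧ AgV (t + 1) ω.2.2 ω'.2.2))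
    + (M.LL (fun ω ω' => ω.1 t.castSucc = ω'.1 t.castSucc ∧
        AgV (t + 1) ω.2.1 ω'.2.1 ∧ AgV (t + 1) ω.2.2 ω'.2.2) -
     M.LL (fun ω ω' => ω.1 t.succ = ω'.1 t.succ ∧ ω.1 t.castSucc = ω'.1 t.castSucc ∧
        AgV (t + 1) ω.2.1 ω'.2.1 ∧ AgV (t + 1) ω.2.2 ω'.2.2)) := by
  unfold CHMM.DD CHMM.LL
  simp only [← Finset.sum_sub_distrib, ← Finset.sum_add_distrib]
  refine Finset.sum_congr rfl fun ω₀ _ => ?_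
  rcases (M.p_nonneg ω₀).eq_or_lt with hp | hp
  · simp [← hp]
  have sU : ∀ v v' : Fin T → U, AgV (t + 1) v v' ↔ AgV t v v' ∧ v t = v' t :=
    AgV.succ_iff _ t rfl
  have sX : ∀ v v' : Fin (T + 1) → X, AgV (t + 1 + 1) v v' ↔ AgV (t + 1) v v' ∧ v t.succ = v' t.succ :=
    AgV.succ_iff _ t.succ (by simp)
  have sY : ∀ v v' : Fin (T + 1) → Y, AgV (t + 1 + 1) v v' ↔ AgV (t + 1) v v' ∧ v t.succ = v' t.succ :=
    AgV.succ_iff _ t.succ (by simp)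
  have rX : ∀ v : Fin (T + 1) → X, ∀ n, AgV n v v := fun v n i hi => rfl
  have rY : ∀ v : Fin (T + 1) → Y, ∀ n, AgV n v v := fun v n i hi => rfl
  have rU : ∀ v : Fin T → U, ∀ n, AgV n v v := fun v n i hi => rfl
  -- policy factor
  have u1 := M.PP_U ω₀ t (fun ω => AgV (t + 1) ω.1 ω₀.1 ∧ AgV (t + 1) ω.2.1 ω₀.2.1 ∧
      AgV t ω.2.2 ω₀.2.2)
    (fun ω ω' h => propext (and_congr (AgV.congr h.1 le_rfl) (and_congr (AgV.congr h.2.1 le_rfl)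
      (AgV.congr h.2.2 le_rfl))))
    (fun ω h => ⟨fun i hi => absurd hi (by omega), h.2.1, h.2.2⟩)
  have u2 := M.PP_U ω₀ t (fun ω => AgV (t + 1) ω.2.1 ω₀.2.1 ∧ AgV t ω.2.2 ω₀.2.2)
    (fun ω ω' h => propext (and_congr (AgV.congr h.2.1 le_rfl)
      (AgV.congr h.2.2 le_rfl)))
    (fun ω h => ⟨fun i hi => absurd hi (by omega), h.1, h.2⟩)
  -- transition factor
  have x1 := M.PP_X ω₀ t (fun ω => AgV (t + 1) ω.1 ω₀.1 ∧ AgV (t + 1) ω.2.1 ω₀.2.1 ∧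
      AgV (t + 1) ω.2.2 ω₀.2.2)
    (fun ω ω' h => propext (and_congr (AgV.congr h.1 le_rfl) (and_congr (AgV.congr h.2.1 le_rfl)
      (AgV.congr h.2.2 le_rfl))))
    (fun ω h => ⟨h.1 _ (by simp), h.2.2 _ (by simp)⟩)
  have x2 := M.PP_X ω₀ t (fun ω => ω.1 t.castSucc = ω₀.1 t.castSucc ∧ AgV (t + 1) ω.2.1 ω₀.2.1 ∧
      AgV (t + 1) ω.2.2 ω₀.2.2)
    (fun ω ω' h => propext (and_congr (by rw [h.1 t.castSucc (by simp)])
      (and_congr (AgV.congr h.2.1 le_rfl) (AgV.congr h.2.2 le_rfl))))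
    (fun ω h => ⟨h.1, h.2.2 _ (by simp)⟩)
  -- measurement factor
  have y1 := M.PP_Y ω₀ t (fun ω => AgV (t + 1 + 1) ω.1 ω₀.1 ∧ AgV (t + 1) ω.2.1 ω₀.2.1 ∧
      AgV (t + 1) ω.2.2 ω₀.2.2)
    (fun ω ω' h => propext (and_congr (AgV.congr h.1 le_rfl) (and_congr (AgV.congr h.2.1 le_rfl)
      (AgV.congr h.2.2 le_rfl))))
    (fun ω h => ⟨h.1 _ (by simp), h.2.2 _ (by simp)⟩)
  have y2 := M.PP_Y ω₀ t (fun ω => ω.1 t.succ = ω₀.1 t.succ ∧ AgV (t + 1) ω.2.1 ω₀.2.1 ∧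
      AgV (t + 1) ω.2.2 ω₀.2.2)
    (fun ω ω' h => propext (and_congr (by rw [h.1 t.succ (by simp)])
      (and_congr (AgV.congr h.2.1 le_rfl) (AgV.congr h.2.2 le_rfl))))
    (fun ω h => ⟨h.1, h.2.2 _ (by simp)⟩)
  have e1 : M.PP (fun ω => (AgV (t + 1) ω.1 ω₀.1 ∧ AgV (t + 1) ω.2.1 ω₀.2.1 ∧
      AgV t ω.2.2 ω₀.2.2) ∧ ω.2.2 t = ω₀.2.2 t) = M.PP (fun ω => AgV (t + 1) ω.1 ω₀.1 ∧
      AgV (t + 1) ω.2.1 ω₀.2.1 ∧ AgV (t + 1) ω.2.2 ω₀.2.2) :=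
    M.PP_congr fun ω => by rw [sU]; tauto
  have e2 : M.PP (fun ω => (AgV (t + 1) ω.2.1 ω₀.2.1 ∧
      AgV t ω.2.2 ω₀.2.2) ∧ ω.2.2 t = ω₀.2.2 t) = M.PP (fun ω =>
      AgV (t + 1) ω.2.1 ω₀.2.1 ∧ AgV (t + 1) ω.2.2 ω₀.2.2) :=
    M.PP_congr fun ω => by rw [sU]; tauto
  have e3 : M.PP (fun ω => (AgV (t + 1) ω.1 ω₀.1 ∧ AgV (t + 1) ω.2.1 ω₀.2.1 ∧
      AgV (t + 1) ω.2.2 ω₀.2.2) ∧ ω.1 t.succ = ω₀.1 t.succ) = M.PP (fun ω =>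
      AgV (t + 1 + 1) ω.1 ω₀.1 ∧
      AgV (t + 1) ω.2.1 ω₀.2.1 ∧ AgV (t + 1) ω.2.2 ω₀.2.2) :=
    M.PP_congr fun ω => by rw [sX]; tauto
  have e4 : M.PP (fun ω => (ω.1 t.castSucc = ω₀.1 t.castSucc ∧ AgV (t + 1) ω.2.1 ω₀.2.1 ∧
      AgV (t + 1) ω.2.2 ω₀.2.2) ∧ ω.1 t.succ = ω₀.1 t.succ) = M.PP (fun ω =>
      ω.1 t.succ = ω₀.1 t.succ ∧ ω.1 t.castSucc = ω₀.1 t.castSucc ∧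
      AgV (t + 1) ω.2.1 ω₀.2.1 ∧ AgV (t + 1) ω.2.2 ω₀.2.2) :=
    M.PP_congr fun ω => by tauto
  have e5 : M.PP (fun ω => (AgV (t + 1 + 1) ω.1 ω₀.1 ∧ AgV (t + 1) ω.2.1 ω₀.2.1 ∧
      AgV (t + 1) ω.2.2 ω₀.2.2) ∧ ω.2.1 t.succ = ω₀.2.1 t.succ) = M.PP (fun ω =>
      AgV (t + 1 + 1) ω.1 ω₀.1 ∧
      AgV (t + 1 + 1) ω.2.1 ω₀.2.1 ∧ AgV (t + 1) ω.2.2 ω₀.2.2) :=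
    M.PP_congr fun ω => by rw [sY]; tauto
  have e6 : M.PP (fun ω => (ω.1 t.succ = ω₀.1 t.succ ∧ AgV (t + 1) ω.2.1 ω₀.2.1 ∧
      AgV (t + 1) ω.2.2 ω₀.2.2) ∧ ω.2.1 t.succ = ω₀.2.1 t.succ) = M.PP (fun ω =>
      ω.1 t.succ = ω₀.1 t.succ ∧
      AgV (t + 1 + 1) ω.2.1 ω₀.2.1 ∧ AgV (t + 1) ω.2.2 ω₀.2.2) :=
    M.PP_congr fun ω => by rw [sY]; tauto
  rw [e1] at u1
  rw [e2] at u2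
  rw [e3] at x1
  rw [e4] at x2
  rw [e5] at y1
  rw [e6] at y2
  have key : ∀ {a k b : ℝ}, a = k * b → 0 < a → Real.log a = Real.log k + Real.log b := by
    intro a k b h ha
    subst h
    exact Real.log_mul (left_ne_zero_of_mul ha.ne') (right_ne_zero_of_mul ha.ne')
  have lu1 := key u1 (M.PP_pos ω₀ hp _ ⟨rX _ _, rY _ _, rU _ _⟩)
  have lu2 := key u2 (M.PP_pos ω₀ hp _ ⟨rY _ _, rU _ _⟩)
  have lx1 := key x1 (M.PP_pos ω₀ hp _ ⟨rX _ _, rY _ _, rU _ _⟩)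
  have lx2 := key x2 (M.PP_pos ω₀ hp _ ⟨rfl, rfl, rY _ _, rU _ _⟩)
  have ly1 := key y1 (M.PP_pos ω₀ hp _ ⟨rX _ _, rY _ _, rU _ _⟩)
  have ly2 := key y2 (M.PP_pos ω₀ hp _ ⟨rfl, rY _ _, rU _ _⟩)
  simp only [← mul_sub, ← mul_add]
  congr 1
  show _ = (Real.log (M.PP fun ω' => AgV (t + 1 + 1) ω'.2.1 ω₀.2.1 ∧ AgV (t + 1) ω'.2.2 ω₀.2.2) -
     Real.log (M.PP fun ω' => ω'.1 t.succ = ω₀.1 t.succ ∧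
        AgV (t + 1 + 1) ω'.2.1 ω₀.2.1 ∧ AgV (t + 1) ω'.2.2 ω₀.2.2)) - _ + _
  linarith

end

end Helpers

/-- Additive decomposition of the smoothing-averse objective:
`H(X^T | Y^T, U^{T-1}) − γ E[∑_{t=0}^{T-1} c_t(X_t, U_t)]
  = H(X_0 | Y_0) + ∑_{t=0}^{T-1} E[r̃_t(Y^{t+1}, U^t) − γ c_t(X_t, U_t)]`,
where `r̃_t(y^{t+1}, u^t) = h(X_{t+1} | y^{t+1}, u^t) − h(X_{t+1} | y^t, u^t)
  + h(X_{t+1} | X_t, y^t, u^t)`. -/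
theorem smoothing_averse_objective_additive_decomposition
    {T : ℕ} {X Y U : Type*} [Fintype X] [Fintype Y] [Fintype U]
    [DecidableEq X] [DecidableEq Y] [DecidableEq U]
    (hT : 1 ≤ T) (M : CHMM T X Y U)
    (c : Fin T → X → U → ℝ) (hc : ∀ t x u, 0 ≤ c t x u) (γ : ℝ) (hγ : 0 ≤ γ) :
    M.condEnt (Xpref T (T + 1) le_rfl)
        (fun ω => (Ypref T (T + 1) le_rfl ω, Upref T T le_rfl ω))
      - γ * (∑ ω : Traj T X Y U, M.p ω * (∑ t : Fin T, c t (ω.1 t.castSucc) (ω.2.2 t)))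
    = M.condEnt (Xat T 0 (by omega)) (Yat T 0 (by omega))
      + ∑ t : Fin T, (∑ ω : Traj T X Y U, M.p ω *
          ((M.pcondEnt (Xat T ((t : ℕ) + 1) (by have := t.isLt; omega))
              (fun ω' => (Ypref T ((t : ℕ) + 2) (by have := t.isLt; omega) ω',
                Upref T ((t : ℕ) + 1) (by have := t.isLt; omega) ω'))
              (Ypref T ((t : ℕ) + 2) (by have := t.isLt; omega) ω,
                Upref T ((t : ℕ) + 1) (by have := t.isLt; omega) ω)
            - M.pcondEnt (Xat T ((t : ℕ) + 1) (by have := t.isLt; omega))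
              (fun ω' => (Ypref T ((t : ℕ) + 1) (by have := t.isLt; omega) ω',
                Upref T ((t : ℕ) + 1) (by have := t.isLt; omega) ω'))
              (Ypref T ((t : ℕ) + 1) (by have := t.isLt; omega) ω,
                Upref T ((t : ℕ) + 1) (by have := t.isLt; omega) ω)
            + M.pcondEnt2 (Xat T ((t : ℕ) + 1) (by have := t.isLt; omega))
              (Xat T (t : ℕ) (by have := t.isLt; omega))
              (fun ω' => (Ypref T ((t : ℕ) + 1) (by have := t.isLt; omega) ω',
                Upref T ((t : ℕ) + 1) (by have := t.isLt; omega) ω'))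
              (Ypref T ((t : ℕ) + 1) (by have := t.isLt; omega) ω,
                Upref T ((t : ℕ) + 1) (by have := t.isLt; omega) ω))
           - γ * c t (ω.1 t.castSucc) (ω.2.2 t))) := by
  have h0 : M.condEnt (Xat T 0 (by omega)) (Yat T 0 (by omega)) = M.DD 0 := by
    rw [M.condEnt_LL]
    unfold CHMM.DD Xat Yat
    have a0 : ∀ {Z : Type _} (v v' : Fin (T + 1) → Z), AgV (0 + 1) v v' ↔ v 0 = v' 0 := by
      intro Z v v'
      rw [AgV.succ_iff 0 0 rfl]
      exact ⟨fun h => h.2, fun h => ⟨fun i hi => absurd hi (by omega), h⟩⟩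
    have a1 : ∀ {Z : Type _} (v v' : Fin (T + 1) → Z), AgV (0 + 1) v v' ↔ v 0 = v' 0 := by
      intro Z v v'
      rw [AgV.succ_iff 0 0 rfl]
      exact ⟨fun h => h.2, fun h => ⟨fun i hi => absurd hi (by omega), h⟩⟩
    have a2 : ∀ v v' : Fin T → U, AgV 0 v v' ↔ True := fun v v' =>
      ⟨fun _ => trivial, fun _ i hi => absurd hi (by omega)⟩
    congr 1
    · exact M.LL_congr fun ω ω' => by rw [a0, a2, and_true]; rfl
    · exact M.LL_congr fun ω ω' => by rw [a0, a1, a2, and_true]; rfl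
  have hTT : M.condEnt (Xpref T (T + 1) le_rfl)
        (fun ω => (Ypref T (T + 1) le_rfl ω, Upref T T le_rfl ω)) = M.DD T := by
    rw [M.condEnt_LL]
    unfold CHMM.DD Xpref Ypref Upref
    simp only [Prod.mk.injEq, pref_iff]
    rfl
  have hsum : M.DD T = M.DD 0 + ∑ t : Fin T, (M.DD (t + 1) - M.DD t) := by
    rw [Fin.sum_univ_eq_sum_range (fun n => M.DD (n + 1) - M.DD n), Finset.sum_range_sub]
    ring
  have hcost : γ * (∑ ω : Traj T X Y U, M.p ω * (∑ t : Fin T, c t (ω.1 t.castSucc) (ω.2.2 t)))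
      = ∑ t : Fin T, ∑ ω : Traj T X Y U, M.p ω * (γ * c t (ω.1 t.castSucc) (ω.2.2 t)) := by
    rw [Finset.sum_comm, Finset.mul_sum]
    refine Finset.sum_congr rfl fun ω _ => ?_
    rw [Finset.mul_sum, Finset.mul_sum]
    exact Finset.sum_congr rfl fun t _ => by ring
  rw [hTT, h0, hsum, hcost, add_sub_assoc, ← Finset.sum_sub_distrib]
  congr 1
  refine Finset.sum_congr rfl fun t _ => ?_
  simp only [mul_sub, mul_add, Finset.sum_sub_distrib, Finset.sum_add_distrib]
  congr 1
  have ht := t.isLt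
  have k1 := M.pcondEnt_LL (Xat T ((t : ℕ) + 1) (by omega))
    (fun ω' => (Ypref T ((t : ℕ) + 2) (by omega) ω', Upref T ((t : ℕ) + 1) (by omega) ω'))
  have k2 := M.pcondEnt_LL (Xat T ((t : ℕ) + 1) (by omega))
    (fun ω' => (Ypref T ((t : ℕ) + 1) (by omega) ω', Upref T ((t : ℕ) + 1) (by omega) ω'))
  have k3 := M.pcondEnt2_LL (Xat T ((t : ℕ) + 1) (by omega)) (Xat T (t : ℕ) (by omega))
    (fun ω' => (Ypref T ((t : ℕ) + 1) (by omega) ω', Upref T ((t : ℕ) + 1) (by omega) ω'))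
  rw [k1, k2, k3, M.DD_succ t]
  unfold Xat Ypref Upref
  simp only [Prod.mk.injEq, pref_iff]
  rfl
end
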